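/- arXiv:0707.3747 — 5 statements merged into one kernel-verified Lean document; each statement's English description precedes it below -/
import Mathlib

section
/- Let N ≥ 1 and k ≥ 1 be integers and let φ : (ℤ/Nℤ)² → ℂ be any function. Then for every τ in the complex upper half plane the series Σ_{(m,n) ∈ ℤ²∖{(0,0)}} φ̂(m mod N, n mod N)·(m + nτ)^{−(k+2)} converges absolutely, and ((−1)^k · N^{k+2} · (k+1)! / (2πi)^{k+2}) · Σ_{(m,n) ∈ ℤ²∖{(0,0)}} φ̂(m mod N, n mod N)·(m + nτ)^{−(k+2)} = (1/2)·L(h, −1−k) + Σ_{M=1}^{∞} exp(2πiMτ/N) · Σ_{d,d' ≥ 1, d·d' = M} ( d^{k+1}·P₁φ(d' mod N, d mod N) − (−d)^{k+1}·P₁φ(−d' mod N, −d mod N) ), where h : ℤ/Nℤ → ℂ is given by h(m) := P₁φ(0, m) − (−1)^{k+1}·P₁φ(0, −m). (This is the q-expansion, at the cusp ∞, of twice the holomorphic Eisenstein series E_{k+2,0,φ}.) -/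
/-- `e(x) = exp(2πi·x̃/N)` for `x : ZMod N`, using the canonical lift `x.val`. -/
noncomputable def eN (N : ℕ) (x : ZMod N) : ℂ :=
  Complex.exp (2 * Real.pi * Complex.I * x.val / N)

/-- The partial Fourier transform `P₁φ(m,n) = Σ_v φ(v,n)·e(mv)`. -/
noncomputable def P1 (N : ℕ) [NeZero N] (φ : ZMod N → ZMod N → ℂ) (m n : ZMod N) : ℂ :=
  ∑ v : ZMod N, φ v n * eN N (m * v)

/-- The symplectic Fourier transform `φ̂(m,n) = (1/N)·Σ_{u,v} φ(u,v)·e(un − mv)`. -/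
noncomputable def sympF (N : ℕ) [NeZero N] (φ : ZMod N → ZMod N → ℂ) (m n : ZMod N) : ℂ :=
  (1 / (N : ℂ)) * ∑ u : ZMod N, ∑ v : ZMod N, φ u v * eN N (u * n - m * v)

/-- The term `φ̂(m mod N, n mod N)·(m + nτ)^{−(k+2)}` of the Eisenstein series, extended by `0`
at `(m,n) = (0,0)`. -/
noncomputable def eisTerm (N : ℕ) [NeZero N] (k : ℕ) (φ : ZMod N → ZMod N → ℂ)
    (τ : UpperHalfPlane) (x : ℤ × ℤ) : ℂ :=
  if x = 0 then 0
  else sympF N φ (x.1 : ZMod N) (x.2 : ZMod N) *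
    ((x.1 : ℂ) + (x.2 : ℂ) * (τ : ℂ)) ^ (-((k : ℤ) + 2))

open Complex ZMod

open UpperHalfPlane hiding I

open scoped Real

section DFT

variable {N : ℕ} [NeZero N]

lemma eN_eq_stdAddChar (x : ZMod N) : eN N x = stdAddChar x := by
  rw [stdAddChar_apply, toCircle_apply, eN]

lemma sympF_eq_dft (φ : ZMod N → ZMod N → ℂ) (m n : ZMod N) :
    sympF N φ m n = (N : ℂ)⁻¹ * 𝓕 (P1 N φ n) m := by
  simp only [sympF, P1, dft_apply, eN_eq_stdAddChar, one_div, smul_eq_mul, Finset.mul_sum]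
  rw [Finset.sum_comm]
  refine Finset.sum_congr rfl fun v _ ↦ Finset.sum_congr rfl fun u _ ↦ ?_
  rw [sub_eq_add_neg, AddChar.map_add_eq_mul, mul_comm u n, mul_comm m v]
  ring

lemma eq_inv_mul_sum_dft (f : ZMod N → ℂ) (d : ZMod N) :
    f d = (N : ℂ)⁻¹ * ∑ a : ZMod N, stdAddChar (a * d) * 𝓕 f a := by
  have := invDFT_apply (𝓕 f) d
  rw [LinearEquiv.symm_apply_apply] at this
  simpa using this

lemma tsum_int_eq_sum_tsum_residue (N : ℕ) [NeZero N] {g : ℤ → ℂ} (hg : Summable g) :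
    ∑' m : ℤ, g m = ∑ a : ZMod N, ∑' j : ℤ, g (j * N + (a.val : ℤ)) := by
  rw [← (Int.divModEquiv N).symm.tsum_eq, ← (Equiv.prodComm _ _).tsum_eq,
    Summable.tsum_prod, tsum_fintype]
  · refine Fintype.sum_equiv (ZMod.finEquiv N).toEquiv _ _ fun a ↦ ?_
    obtain ⟨n, rfl⟩ := Nat.exists_eq_succ_of_ne_zero (NeZero.ne N)
    refine tsum_congr fun j ↦ ?_
    simp [Int.divModEquiv]
    rfl
  · exact (Equiv.prodComm _ _).summable_iff.mpr ((Int.divModEquiv N).symm.summable_iff.mpr hg)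

end DFT

lemma norm_bounded_of_finite {α : Type*} [Finite α] (f : α → ℂ) : ∃ C, 0 ≤ C ∧ ∀ a, ‖f a‖ ≤ C := by
  cases nonempty_fintype α
  exact ⟨∑ a, ‖f a‖, by positivity, fun a ↦
    Finset.single_le_sum (f := fun a ↦ ‖f a‖) (fun _ _ ↦ norm_nonneg _) (Finset.mem_univ a)⟩

section Lipschitz

variable {N : ℕ} [NeZero N]

lemma summable_mul_inv_add_pow (f : ZMod N → ℂ) {k : ℕ} (hk : 1 ≤ k) (z : ℍ) :
    Summable fun m : ℤ ↦ f m * (((m : ℂ) + z) ^ (k + 1))⁻¹ := by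
  obtain ⟨C, hC, hf⟩ := norm_bounded_of_finite f
  have h := EisensteinSeries.linear_right_summable (z : ℂ) 1 (k := (k + 1 : ℕ)) (by lia)
  refine (h.norm.mul_left C).of_norm_bounded fun m ↦ ?_
  rw [norm_mul]
  refine mul_le_mul (hf _) (le_of_eq ?_) (norm_nonneg _) hC
  rw [zpow_natCast, Int.cast_one, one_mul, add_comm]

lemma tsum_dft_mul_inv_add_pow (f : ZMod N → ℂ) {k : ℕ} (hk : 1 ≤ k) (z : ℍ) :
    ∑' m : ℤ, 𝓕 f m * (((m : ℂ) + z) ^ (k + 1))⁻¹ =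
      (N : ℂ) * ((-2 * π * I / N) ^ (k + 1) / (k.factorial : ℂ)) *
        ∑' d : ℕ, f d * ((d : ℂ) ^ k * cexp (2 * π * I * z / N) ^ d) := by
  have hN : (N : ℂ) ≠ 0 := NeZero.ne _
  have hNpos : (0 : ℝ) < N := by exact_mod_cast NeZero.pos N
  let w (a : ZMod N) : ℍ := ⟨(a.val + z) / N, by
    rw [div_natCast_im, add_im, natCast_im, zero_add]
    exact div_pos z.2 hNpos⟩
  have hw (a : ZMod N) : (w a : ℂ) = (a.val + z) / N := rfl
  have hexp (a : ZMod N) (d : ℕ) : cexp (2 * π * I * w a) ^ d =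
      stdAddChar (a * (d : ZMod N)) * cexp (2 * π * I * z / N) ^ d := by
    have : a * (d : ZMod N) = d • a := by simp [mul_comm]
    rw [this, AddChar.map_nsmul_eq_pow, ← mul_pow, stdAddChar_apply, toCircle_apply, ← exp_add, hw]
    congr 2
    field_simp
  have hsum (a : ZMod N) : Summable fun d : ℕ ↦ (d : ℂ) ^ k * cexp (2 * π * I * w a) ^ d := by
    simpa using summable_pow_mul_cexp k 1 (w a)
  rw [tsum_int_eq_sum_tsum_residue N (summable_mul_inv_add_pow _ hk z)]
  have hrow (a : ZMod N) : ∑' j : ℤ, 𝓕 f ((j * N + (a.val : ℤ) : ℤ) : ZMod N) *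
        ((((j * N + (a.val : ℤ) : ℤ) : ℂ) + z) ^ (k + 1))⁻¹ =
      𝓕 f a * ((-2 * π * I / N) ^ (k + 1) / (k.factorial : ℂ) *
        ∑' d : ℕ, (d : ℂ) ^ k * cexp (2 * π * I * w a) ^ d) := by
    have hterm (j : ℤ) : 𝓕 f ((j * N + (a.val : ℤ) : ℤ) : ZMod N) *
        ((((j * N + (a.val : ℤ) : ℤ) : ℂ) + z) ^ (k + 1))⁻¹ =
        𝓕 f a * ((N : ℂ) ^ (k + 1))⁻¹ * (1 / ((w a : ℂ) + j) ^ (k + 1)) := by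
      have h1 : ((j * N + (a.val : ℤ) : ℤ) : ZMod N) = a := by simp
      have h2 : ((j * N + (a.val : ℤ) : ℤ) : ℂ) + z = N * ((w a : ℂ) + j) := by
        rw [hw]
        push_cast
        field_simp
        ring
      rw [h1, h2, mul_pow, mul_inv, one_div, mul_assoc]
    simp_rw [hterm]
    rw [tsum_mul_left, EisensteinSeries.qExpansion_identity hk (w a), div_pow]
    ring
  simp_rw [hrow]
  have hf (d : ℕ) : f d * ((d : ℂ) ^ k * cexp (2 * π * I * z / N) ^ d) =
      (N : ℂ)⁻¹ * ∑ a : ZMod N, 𝓕 f a * ((d : ℂ) ^ k * cexp (2 * π * I * w a) ^ d) := by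
    rw [eq_inv_mul_sum_dft f d, mul_assoc, Finset.sum_mul]
    congr 1
    refine Finset.sum_congr rfl fun a _ ↦ ?_
    rw [hexp]
    ring
  simp_rw [hf]
  rw [tsum_mul_left, Summable.tsum_finsetSum fun a _ ↦ (hsum a).mul_left _]
  simp_rw [tsum_mul_left, Finset.mul_sum]
  refine Finset.sum_congr rfl fun a _ ↦ ?_
  field_simp

end Lipschitz

lemma norm_cexp_two_pi_I_mul_div_lt_one (N : ℕ) [NeZero N] (τ : ℍ) :
    ‖cexp (2 * π * I * τ / N)‖ < 1 := by
  have hN : (0 : ℝ) < N := by exact_mod_cast NeZero.pos N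
  have := norm_exp_two_pi_I_lt_one ⟨(τ : ℂ) / N, by
    rw [div_natCast_im]; exact div_pos τ.2 hN⟩
  rwa [← mul_div_assoc] at this

lemma summable_bounded_mul_prod_mul_pow {G : ℕ → ℕ → ℂ} {C : ℝ} (hG : ∀ n d, ‖G n d‖ ≤ C)
    (k : ℕ) {q : ℂ} (hq : ‖q‖ < 1) :
    Summable fun x : ℕ+ × ℕ+ ↦ G x.1 x.2 * ((x.2 : ℂ) ^ k * q ^ (x.1 * x.2 : ℕ)) := by
  refine ((summable_prod_mul_pow k hq).norm.mul_left C).of_norm_bounded fun x ↦ ?_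
  rw [norm_mul]
  exact mul_le_mul_of_nonneg_right (hG _ _) (norm_nonneg _)

lemma tsum_tsum_eq_tsum_sum_divisors {G : ℕ → ℕ → ℂ} {C : ℝ} (hG : ∀ n d, ‖G n d‖ ≤ C)
    (k : ℕ) {q : ℂ} (hq : ‖q‖ < 1) :
    ∑' n : ℕ+, ∑' d : ℕ+, G n d * ((d : ℂ) ^ k * q ^ (n * d : ℕ)) =
      ∑' M : ℕ+, q ^ (M : ℕ) * ∑ d ∈ (M : ℕ).divisors, (d : ℂ) ^ k * G (M / d) d := by
  have hs := summable_bounded_mul_prod_mul_pow hG k hq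
  rw [← hs.tsum_prod, ← sigmaAntidiagonalEquivProd.tsum_eq]
  refine ((sigmaAntidiagonalEquivProd.summable_iff.mpr hs :).tsum_sigma).trans (tsum_congr fun M ↦ ?_)
  simp only [Function.comp_apply, sigmaAntidiagonalEquivProd, divisorsAntidiagonalFactors, PNat.mk_coe,
    Equiv.coe_fn_mk, tsum_fintype, Finset.univ_eq_attach]
  rw [(M : ℕ).divisorsAntidiagonal.sum_attach
      fun x : ℕ × ℕ ↦ G x.1 x.2 * ((x.2 : ℂ) ^ k * q ^ (x.1 * x.2)),
    Nat.sum_divisorsAntidiagonal' fun x y ↦ G x y * ((y : ℂ) ^ k * q ^ (x * y)), Finset.mul_sum]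
  refine Finset.sum_congr rfl fun d hd ↦ ?_
  rw [Nat.div_mul_cancel (Nat.dvd_of_mem_divisors hd)]
  ring

section Eisenstein

variable {N : ℕ} [NeZero N]

lemma eisTerm_eq (k : ℕ) (φ : ZMod N → ZMod N → ℂ) (τ : ℍ) (x : ℤ × ℤ) :
    eisTerm N k φ τ x =
      (N : ℂ)⁻¹ * (𝓕 (P1 N φ x.2) x.1 * (((x.1 : ℂ) + x.2 * τ) ^ (k + 2))⁻¹) := by
  rw [eisTerm]
  split_ifs with h
  · simp [h]
  · rw [sympF_eq_dft, zpow_neg, mul_assoc]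
    norm_cast

lemma summable_eisTerm {k : ℕ} (hk : 1 ≤ k) (φ : ZMod N → ZMod N → ℂ) (τ : ℍ) :
    Summable (eisTerm N k φ τ) := by
  obtain ⟨C, hC, hf⟩ := norm_bounded_of_finite fun x : ZMod N × ZMod N ↦ sympF N φ x.1 x.2
  have h := (Equiv.prodComm ℤ ℤ).summable_iff.mpr
    (summable_prod_eisSummand (k := k + 2) (by lia) τ)
  refine (h.norm.mul_left C).of_norm_bounded fun x ↦ ?_
  rw [eisTerm]
  split_ifs with hx
  · simpa using by positivity
  · rw [norm_mul]
    refine mul_le_mul (hf (_, _)) (le_of_eq ?_) (norm_nonneg _) hC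
    simp [EisensteinSeries.eisSummand, add_comm]

lemma tsum_dft_mul_inv_add_mul_pow (f : ZMod N → ℂ) (k : ℕ) (τ : ℍ) (n : ℕ+) :
    ∑' m : ℤ, 𝓕 f m * (((m : ℂ) + n * τ) ^ (k + 2))⁻¹ =
      (N : ℂ) * ((-2 * π * I / N) ^ (k + 2) / ((k + 1).factorial : ℂ)) *
        ∑' d : ℕ+, f d * ((d : ℂ) ^ (k + 1) * cexp (2 * π * I * τ / N) ^ (n * d : ℕ)) := by
  have hn : (0 : ℝ) < n := by exact_mod_cast n.pos
  let z : ℍ := ⟨n * τ, by simpa using mul_pos hn τ.2⟩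
  have hz : (z : ℂ) = n * τ := rfl
  have := tsum_dft_mul_inv_add_pow f (k := k + 1) (by lia) z
  rw [hz] at this
  rw [this]
  congr 1
  have hexp (d : ℕ) : cexp (2 * π * I * (n * τ) / N) ^ d =
      cexp (2 * π * I * τ / N) ^ (n * d : ℕ) := by
    rw [pow_mul, ← Complex.exp_nat_mul _ (n : ℕ)]
    congr 2
    ring
  simp_rw [hexp]
  exact (tsum_pnat_eq_tsum_of_eq_zero (f := fun d : ℕ ↦ f d *
    ((d : ℂ) ^ (k + 1) * cexp (2 * π * I * τ / N) ^ (n * d : ℕ))) (by simp)).symm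

lemma tsum_eisTerm_row_pos (k : ℕ) (φ : ZMod N → ZMod N → ℂ) (τ : ℍ) (n : ℕ+) :
    ∑' m : ℤ, eisTerm N k φ τ (m, n) =
      (-2 * π * I / N) ^ (k + 2) / ((k + 1).factorial : ℂ) *
        ∑' d : ℕ+, P1 N φ (n : ℕ) d *
          ((d : ℂ) ^ (k + 1) * cexp (2 * π * I * τ / N) ^ (n * d : ℕ)) := by
  have hN : (N : ℂ) ≠ 0 := NeZero.ne _
  have := tsum_dft_mul_inv_add_mul_pow (P1 N φ (n : ℕ)) k τ n
  simp_rw [eisTerm_eq, tsum_mul_left]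
  push_cast at this ⊢
  rw [this]
  field_simp

lemma tsum_eisTerm_row_neg (k : ℕ) (φ : ZMod N → ZMod N → ℂ) (τ : ℍ) (n : ℕ+) :
    ∑' m : ℤ, eisTerm N k φ τ (m, -n) =
      (-1) ^ k * ((-2 * π * I / N) ^ (k + 2) / ((k + 1).factorial : ℂ)) *
        ∑' d : ℕ+, P1 N φ (-(n : ℕ)) (-d) *
          ((d : ℂ) ^ (k + 1) * cexp (2 * π * I * τ / N) ^ (n * d : ℕ)) := by
  have hN : (N : ℂ) ≠ 0 := NeZero.ne _
  have := tsum_dft_mul_inv_add_mul_pow (fun d ↦ P1 N φ (-(n : ℕ)) (-d)) k τ n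
  rw [dft_comp_neg] at this
  rw [← (Equiv.neg ℤ).tsum_eq]
  have hterm (m : ℤ) : eisTerm N k φ τ (Equiv.neg ℤ m, -n) = (N : ℂ)⁻¹ * (-1) ^ k *
      (𝓕 (P1 N φ (-(n : ℕ))) (-m) * (((m : ℂ) + n * τ) ^ (k + 2))⁻¹) := by
    have h : ((-m : ℤ) : ℂ) + ((-n : ℤ) : ℂ) * τ = (-1) * (m + n * τ) := by
      push_cast
      ring
    rw [eisTerm_eq, Equiv.neg_apply]
    dsimp only
    rw [h, mul_pow (-1 : ℂ), mul_inv, ← inv_pow, show ((-1 : ℂ))⁻¹ = -1 by norm_num,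
      pow_add (-1 : ℂ), neg_one_sq]
    push_cast
    ring
  simp_rw [hterm, tsum_mul_left]
  push_cast at this ⊢
  rw [this]
  field_simp

lemma tsum_eisTerm_row_zero {k : ℕ} (hk : 1 ≤ k) (φ : ZMod N → ZMod N → ℂ) (τ : ℍ) :
    ∑' m : ℤ, eisTerm N k φ τ (m, 0) =
      (N : ℂ)⁻¹ * LFunction (𝓕 fun m ↦ P1 N φ 0 m - (-1) ^ (k + 1) * P1 N φ 0 (-m)) (k + 2) := by
  have hs : Summable fun m : ℤ ↦ eisTerm N k φ τ (m, 0) :=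
    (summable_eisTerm hk φ τ).comp_injective (Prod.mk_left_injective 0)
  have hs1 : Summable fun m : ℕ+ ↦ eisTerm N k φ τ (((m : ℕ) : ℤ), 0) :=
    hs.comp_injective (i := fun m : ℕ+ ↦ ((m : ℕ) : ℤ)) fun a b h ↦ by simpa using h
  have hs2 : Summable fun m : ℕ+ ↦ eisTerm N k φ τ (-((m : ℕ) : ℤ), 0) :=
    hs.comp_injective (i := fun m : ℕ+ ↦ -((m : ℕ) : ℤ)) fun a b h ↦ by simpa using h
  have hdft : (𝓕 fun m ↦ P1 N φ 0 m - (-1) ^ (k + 1) * P1 N φ 0 (-m)) =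
      fun m ↦ 𝓕 (P1 N φ 0) m + (-1) ^ k * 𝓕 (P1 N φ 0) (-m) := by
    have h : (fun m ↦ P1 N φ 0 m - (-1) ^ (k + 1) * P1 N φ 0 (-m)) =
        P1 N φ 0 + fun m ↦ (-1) ^ k * P1 N φ 0 (-m) := by
      ext m
      simp only [Pi.add_apply]
      ring
    rw [h, map_add, dft_const_mul, dft_comp_neg]
    rfl
  rw [tsum_int_eq_zero_add_tsum_pnat hs, add_assoc, ← hs1.tsum_add hs2, hdft,
    LFunction_eq_LSeries _ (by simp; linarith), LSeries,
    ← tsum_pnat_eq_tsum_of_eq_zero (LSeries.term_zero _ _), ← tsum_mul_left]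
  have h0 : eisTerm N k φ τ (0, 0) = 0 := if_pos rfl
  rw [h0, zero_add]
  refine tsum_congr fun m ↦ ?_
  have hneg : (-(m : ℂ)) ^ (k + 2) = (-1) ^ k * (m : ℂ) ^ (k + 2) := by
    rw [neg_pow, pow_add (-1 : ℂ), neg_one_sq, mul_one]
  have hinv : ((-1 : ℂ) ^ k)⁻¹ = (-1) ^ k := by
    rw [← inv_pow]
    norm_num
  have hcpow : (m : ℂ) ^ ((k : ℂ) + 2) = (m : ℂ) ^ (k + 2) := by
    exact_mod_cast cpow_natCast (m : ℂ) (k + 2)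
  rw [LSeries.term_of_ne_zero m.ne_zero, hcpow, eisTerm_eq, eisTerm_eq]
  push_cast
  rw [zero_mul, add_zero, add_zero, hneg, mul_inv, hinv]
  ring

lemma LFunction_neg_one_sub_natCast {h : ZMod N → ℂ} {k : ℕ}
    (hh : ∀ x, h (-x) = (-1) ^ k * h x) :
    LFunction h (-1 - k) = 2 * N ^ (k + 1) * ((2 * π : ℂ) ^ (k + 2))⁻¹ * ((k + 1).factorial : ℂ) *
      I ^ (k + 2) * LFunction (𝓕 h) (k + 2) := by
  have hne (n : ℕ) : (k + 2 : ℂ) ≠ -n := fun h ↦ by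
    have : ((k + 2 + n : ℕ) : ℂ) = 0 := by
      push_cast
      rw [h]
      ring
    rw [Nat.cast_eq_zero] at this
    lia
  have hne1 : (k + 2 : ℂ) ≠ 1 := by
    norm_cast
    lia
  have hF := LFunction_one_sub h hne (Or.inr hne1)
  have hL : LFunction (𝓕 fun x ↦ h (-x)) (k + 2) = (-1) ^ k * LFunction (𝓕 h) (k + 2) := by
    simp_rw [hh, dft_const_mul, LFunction, Finset.mul_sum]
    refine Finset.sum_congr rfl fun j _ ↦ ?_
    ring
  have hI : cexp (π * I * (k + 2) / 2) = I ^ (k + 2) := by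
    have h : I ^ (k + 2) = cexp (π / 2 * I) ^ (k + 2) := by rw [exp_pi_div_two_mul_I]
    rw [h, ← Complex.exp_nat_mul]
    congr 1
    push_cast
    ring
  have hI' : cexp (-π * I * (k + 2) / 2) = (-1) ^ k * I ^ (k + 2) := by
    rw [show (-π * I * (k + 2) / 2 : ℂ) = -(π * I * (k + 2) / 2) by ring, Complex.exp_neg, hI,
      ← inv_pow, inv_I, neg_pow, pow_add (-1 : ℂ), neg_one_sq, mul_one]
  have hN : (N : ℂ) ^ ((k + 2 : ℂ) - 1) = N ^ (k + 1) := by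
    rw [← cpow_natCast]
    congr 1
    push_cast
    ring
  have hpi : (2 * π : ℂ) ^ (-(k + 2 : ℂ)) = ((2 * π : ℂ) ^ (k + 2))⁻¹ := by
    rw [cpow_neg]
    congr 1
    rw [← cpow_natCast]
    congr 1
    push_cast
    ring
  have hG : Complex.Gamma (k + 2) = (k + 1).factorial := by
    rw [← Complex.Gamma_nat_eq_factorial]
    congr 1
    push_cast
    ring
  have hsq : ((-1 : ℂ) ^ k) * (-1) ^ k = 1 := by rw [← mul_pow]; simp
  rw [show (-1 - k : ℂ) = 1 - (k + 2) by ring, hF, hL, hI, hI', hN, hpi, hG]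
  linear_combination (N ^ (k + 1) * ((2 * π : ℂ) ^ (k + 2))⁻¹ * ((k + 1).factorial : ℂ) *
      I ^ (k + 2) * LFunction (𝓕 h) (k + 2)) * hsq

lemma tsum_eisTerm {k : ℕ} (hk : 1 ≤ k) (φ : ZMod N → ZMod N → ℂ) (τ : ℍ) :
    ∑' x : ℤ × ℤ, eisTerm N k φ τ x =
      ∑' m : ℤ, eisTerm N k φ τ (m, 0) +
      (-2 * π * I / N) ^ (k + 2) / ((k + 1).factorial : ℂ) *
        ∑' M : ℕ+, cexp (2 * π * I * τ / N) ^ (M : ℕ) * ∑ d ∈ (M : ℕ).divisors,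
          (d : ℂ) ^ (k + 1) * (P1 N φ (M / d : ℕ) d + (-1) ^ k * P1 N φ (-(M / d : ℕ)) (-d)) := by
  have hsum : Summable fun x : ℤ × ℤ ↦ eisTerm N k φ τ (x.2, x.1) :=
    (summable_eisTerm hk φ τ).prod_symm
  have hq := norm_cexp_two_pi_I_mul_div_lt_one N τ
  obtain ⟨C, hC, hP⟩ := norm_bounded_of_finite fun x : ZMod N × ZMod N ↦ P1 N φ x.1 x.2
  have hbound (n d : ℕ) : ‖P1 N φ n d + (-1) ^ k * P1 N φ (-n) (-d)‖ ≤ C + C := by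
    refine (norm_add_le _ _).trans (add_le_add (hP (_, _)) ?_)
    rw [norm_mul, norm_pow, norm_neg, norm_one, one_pow, one_mul]
    exact hP (_, _)
  have hpos := summable_bounded_mul_prod_mul_pow (G := fun n d ↦ P1 N φ n d)
    (fun n d ↦ hP (_, _)) (k + 1) hq
  have hneg := summable_bounded_mul_prod_mul_pow (G := fun n d ↦ P1 N φ (-n) (-d))
    (fun n d ↦ hP (_, _)) (k + 1) hq
  rw [← tsum_tsum_eq_tsum_sum_divisors
    (G := fun n d ↦ P1 N φ n d + (-1) ^ k * P1 N φ (-n) (-d)) hbound (k + 1) hq]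
  have hG (n : ℕ+) : ∑' d : ℕ+, (P1 N φ (n : ℕ) (d : ℕ) +
        (-1) ^ k * P1 N φ (-(n : ℕ)) (-(d : ℕ))) *
          ((d : ℂ) ^ (k + 1) * cexp (2 * π * I * τ / N) ^ (n * d : ℕ)) =
      ∑' d : ℕ+, P1 N φ (n : ℕ) (d : ℕ) *
        ((d : ℂ) ^ (k + 1) * cexp (2 * π * I * τ / N) ^ (n * d : ℕ)) +
      (-1) ^ k * ∑' d : ℕ+, P1 N φ (-(n : ℕ)) (-(d : ℕ)) *
        ((d : ℂ) ^ (k + 1) * cexp (2 * π * I * τ / N) ^ (n * d : ℕ)) := by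
    rw [← tsum_mul_left, ← (hpos.prod_factor n).tsum_add ((hneg.prod_factor n).mul_left _)]
    refine tsum_congr fun d ↦ ?_
    ring
  rw [← (Equiv.prodComm ℤ ℤ).tsum_eq]
  refine hsum.tsum_prod.trans ?_
  rw [tsum_int_eq_zero_add_tsum_pnat hsum.prod, add_assoc]
  simp_rw [hG]
  rw [hpos.prod.tsum_add (hneg.prod.mul_left _), tsum_mul_left]
  simp_rw [tsum_eisTerm_row_pos, tsum_eisTerm_row_neg, tsum_mul_left]
  ring

lemma two_pi_I_mul_tsum_eisTerm {k : ℕ} (hk : 1 ≤ k) (φ : ZMod N → ZMod N → ℂ) (τ : ℍ) :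
    ((-1 : ℂ) ^ k * (N : ℂ) ^ (k + 2) * ((k + 1).factorial : ℂ) / (2 * π * I) ^ (k + 2)) *
        (∑' x : ℤ × ℤ, eisTerm N k φ τ x) =
      (1 / 2) * LFunction (fun m ↦ P1 N φ 0 m - (-1 : ℂ) ^ (k + 1) * P1 N φ 0 (-m)) (-1 - k) +
        ∑' M : ℕ, (if M = 0 then (0 : ℂ) else cexp (2 * π * I * M * τ / N) *
          ∑ d ∈ M.divisors, ((d : ℂ) ^ (k + 1) * P1 N φ (M / d : ℕ) d -
            (-(d : ℂ)) ^ (k + 1) * P1 N φ (-(M / d : ℕ)) (-d))) := by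
  have hN : (N : ℂ) ≠ 0 := NeZero.ne _
  have hpi : (π : ℂ) ≠ 0 := by exact_mod_cast Real.pi_ne_zero
  have hfac : ((k + 1).factorial : ℂ) ≠ 0 := by exact_mod_cast (k + 1).factorial_ne_zero
  have hsq : ((-1 : ℂ) ^ k) * (-1) ^ k = 1 := by rw [← mul_pow]; simp
  have hh (x : ZMod N) : P1 N φ 0 (-x) - (-1) ^ (k + 1) * P1 N φ 0 (-(-x)) =
      (-1) ^ k * (P1 N φ 0 x - (-1) ^ (k + 1) * P1 N φ 0 (-x)) := by
    rw [neg_neg]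
    linear_combination -P1 N φ 0 (-x) * hsq
  rw [LFunction_neg_one_sub_natCast hh, tsum_eisTerm hk, tsum_eisTerm_row_zero hk, mul_add]
  congr 1
  · have hI : (I ^ (k + 2))⁻¹ = (-1) ^ k * I ^ (k + 2) := by
      rw [← inv_pow, inv_I, neg_pow, pow_add (-1 : ℂ), neg_one_sq, mul_one]
    rw [mul_pow (2 * π : ℂ) I, div_eq_mul_inv, mul_inv, hI, pow_succ (N : ℂ) (k + 1)]
    field_simp
    linear_combination
      LFunction (𝓕 fun m ↦ P1 N φ 0 m - (-1) ^ (k + 1) * P1 N φ 0 (-m)) (k + 2) * hsq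
  · have hc : ((-1 : ℂ) ^ k * (N : ℂ) ^ (k + 2) * ((k + 1).factorial : ℂ) /
        (2 * π * I) ^ (k + 2)) * ((-2 * π * I / N) ^ (k + 2) / ((k + 1).factorial : ℂ)) = 1 := by
      have h : (-2 * π * I : ℂ) ^ (k + 2) = (-1) ^ k * (2 * π * I) ^ (k + 2) := by
        rw [show (-2 * π * I : ℂ) = -(2 * π * I) by ring, neg_pow, pow_add (-1 : ℂ), neg_one_sq,
          mul_one]
      have hne : (2 * π * I : ℂ) ^ (k + 2) ≠ 0 := pow_ne_zero _ two_pi_I_ne_zero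
      rw [div_pow, h]
      generalize (2 * π * I : ℂ) ^ (k + 2) = x at hne
      field_simp
      linear_combination hsq
    rw [← mul_assoc, hc, one_mul]
    refine Eq.trans ?_ (tsum_pnat_eq_tsum_of_eq_zero (if_pos rfl))
    refine tsum_congr fun M ↦ ?_
    rw [if_neg M.ne_zero, ← Complex.exp_nat_mul]
    congr 1
    · congr 1
      ring
    · refine Finset.sum_congr rfl fun d _ ↦ ?_
      rw [neg_pow]
      ring

end Eisenstein

theorem statement0 (N k : ℕ) (hN : 1 ≤ N) (hk : 1 ≤ k)
    (φ : ZMod N → ZMod N → ℂ) (τ : UpperHalfPlane) :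
    letI : NeZero N := ⟨by omega⟩
    Summable (eisTerm N k φ τ) ∧
      ((-1 : ℂ) ^ k * (N : ℂ) ^ (k + 2) * (Nat.factorial (k + 1) : ℂ) /
            (2 * Real.pi * Complex.I) ^ (k + 2)) * (∑' x : ℤ × ℤ, eisTerm N k φ τ x) =
        (1 / 2) * ZMod.LFunction
            (fun m => P1 N φ 0 m - (-1 : ℂ) ^ (k + 1) * P1 N φ 0 (-m)) (-1 - (k : ℂ)) +
          ∑' M : ℕ, (if M = 0 then (0 : ℂ) else
            Complex.exp (2 * Real.pi * Complex.I * (M : ℂ) * (τ : ℂ) / N) *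
              ∑ d ∈ M.divisors,
                ((d : ℂ) ^ (k + 1) * P1 N φ (((M / d : ℕ) : ZMod N)) ((d : ZMod N)) -
                  (-(d : ℂ)) ^ (k + 1) *
                    P1 N φ (-((M / d : ℕ) : ZMod N)) (-((d : ZMod N))))) := by
  have : NeZero N := ⟨by omega⟩
  exact ⟨summable_eisTerm hk φ τ, two_pi_I_mul_tsum_eisTerm hk φ τ⟩
end

section
/- Let N ≥ 1 and k ≥ 1 be integers and let φ : (ℤ/Nℤ)² → ℂ be any function. Then there exists a modular form F of weight k+2 for the principal congruence subgroup Γ(N) of SL₂(ℤ) whose underlying function on the upper half plane is τ ↦ Σ_{(m,n) ∈ ℤ²∖{(0,0)}} φ̂(m mod N, n mod N)·(m + nτ)^{−(k+2)}. (Up to the normalizing constant (−1)^{k+2}·N^{k+2}·(k+1)!/(2·(2πi)^{k+2}), this is the Eisenstein series E_{k+2,0,φ} of weight k+2.) -/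
open UpperHalfPlane EisensteinSeries CongruenceSubgroup Matrix ModularForm
open scoped MatrixGroups Manifold

/-- The Eisenstein series `∑ c(v) (v₀ z + v₁)^(-k)` over all `v ∈ ℤ²`, with weights `c`. -/
noncomputable def weightedEisensteinSeries (c : (Fin 2 → ℤ) → ℂ) (k : ℤ) (z : ℍ) : ℂ :=
  ∑' v : Fin 2 → ℤ, c v * eisSummand k v z

/-- Right multiplication by an element of `SL(2, ℤ)` as a permutation of `ℤ²`. -/
def vecMulEquiv (γ : SL(2, ℤ)) : (Fin 2 → ℤ) ≃ (Fin 2 → ℤ) where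
  toFun v := v ᵥ* (γ : Matrix (Fin 2) (Fin 2) ℤ)
  invFun v := v ᵥ* ((γ⁻¹ : SL(2, ℤ)) : Matrix (Fin 2) (Fin 2) ℤ)
  left_inv v := by
    beta_reduce
    rw [vecMul_vecMul, show γ.1 * (γ⁻¹).1 = 1 from congrArg Subtype.val (mul_inv_cancel γ),
      vecMul_one]
  right_inv v := by
    beta_reduce
    rw [vecMul_vecMul, show (γ⁻¹).1 * γ.1 = 1 from congrArg Subtype.val (inv_mul_cancel γ),
      vecMul_one]

lemma weightedEisensteinSeries_slash (c : (Fin 2 → ℤ) → ℂ) (k : ℤ) (γ : SL(2, ℤ)) :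
    weightedEisensteinSeries c k ∣[k] γ =
      weightedEisensteinSeries
        (fun v ↦ c (v ᵥ* ((γ⁻¹ : SL(2, ℤ)) : Matrix (Fin 2) (Fin 2) ℤ))) k := by
  ext1 z
  rw [SL_slash_apply, _root_.zpow_neg, mul_inv_eq_iff_eq_mul₀ (zpow_ne_zero _ <| denom_ne_zero _ z)]
  simp_rw [weightedEisensteinSeries, eisSummand_SL2_apply, mul_left_comm (c _), tsum_mul_left,
    mul_comm _ (_ ^ k)]
  congr 1
  rw [← (vecMulEquiv γ).tsum_eq
    (fun v ↦ c (v ᵥ* ((γ⁻¹ : SL(2, ℤ)) : Matrix (Fin 2) (Fin 2) ℤ)) * eisSummand k v z)]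
  refine tsum_congr fun v ↦ ?_
  change c v * _ = c ((vecMulEquiv γ).symm (vecMulEquiv γ v)) * _
  rw [Equiv.symm_apply_apply]
  rfl

/-- The slash-invariant form attached to a weight that is invariant under `Γ(N)`. -/
noncomputable def weightedEisensteinSeriesSIF {N : ℕ} (c : (Fin 2 → ℤ) → ℂ)
    (hc : ∀ γ ∈ Gamma N, ∀ v : Fin 2 → ℤ, c (v ᵥ* (γ : Matrix (Fin 2) (Fin 2) ℤ)) = c v) (k : ℤ) :
    SlashInvariantForm (Gamma N) k where
  toFun := weightedEisensteinSeries c k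
  slash_action_eq' A hA := by
    obtain ⟨A, (hA : A ∈ Gamma N), rfl⟩ := hA
    have h : (fun v ↦ c (v ᵥ* ((A⁻¹ : SL(2, ℤ)) : Matrix (Fin 2) (Fin 2) ℤ))) = c :=
      funext (hc _ (inv_mem hA))
    have := weightedEisensteinSeries_slash c k A
    rw [h] at this
    simpa [SpecialLinearGroup.mapGL, ← SL_slash] using this

lemma weightedEisensteinSeries_tendstoLocallyUniformly {c : (Fin 2 → ℤ) → ℂ} {C : ℝ}
    (hC : ∀ v, ‖c v‖ ≤ C) {k : ℤ} (hk : 3 ≤ k) :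
    TendstoLocallyUniformly
      (fun (s : Finset (Fin 2 → ℤ)) (z : ℍ) ↦ ∑ v ∈ s, c v * eisSummand k v z)
      (weightedEisensteinSeries c k) Filter.atTop := by
  have hk' : (2 : ℝ) < k := by norm_cast
  have p_sum : Summable fun x : Fin 2 → ℤ ↦ ‖x‖ ^ (-k) :=
    mod_cast summable_one_div_norm_rpow hk'
  have hC0 : 0 ≤ C := (norm_nonneg _).trans (hC 0)
  simp only [tendstoLocallyUniformly_iff_forall_isCompact]
  intro K hK
  obtain ⟨A, B, hB, HABK⟩ := subset_verticalStrip_of_isCompact hK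
  refine (tendstoUniformlyOn_tsum
    (hu := (p_sum.mul_left <| r ⟨⟨A, B⟩, hB⟩ ^ (-k : ℝ)).mul_left C)
    (fun v z hz ↦ ?_)).mono HABK
  rw [norm_mul]
  refine mul_le_mul (hC v) ?_ (norm_nonneg _) hC0
  simpa only [eisSummand, one_div, ← _root_.zpow_neg, norm_zpow, ← Real.rpow_intCast,
    Int.cast_neg] using summand_bound_of_mem_verticalStrip (by positivity) v hB hz

lemma weightedEisensteinSeries_mdifferentiable {c : (Fin 2 → ℤ) → ℂ} {C : ℝ}
    (hC : ∀ v, ‖c v‖ ≤ C) {k : ℤ} (hk : 3 ≤ k) :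
    MDifferentiable 𝓘(ℂ) 𝓘(ℂ) (weightedEisensteinSeries c k) := by
  rw [UpperHalfPlane.mdifferentiable_iff]
  have h : TendstoLocallyUniformlyOn (fun (s : Finset (Fin 2 → ℤ)) ↦
      (fun (z : ℍ) ↦ ∑ v ∈ s, c v * eisSummand k v z) ∘ ofComplex)
      (weightedEisensteinSeries c k ∘ ofComplex) Filter.atTop {z : ℂ | 0 < z.im} := by
    rw [← upperHalfPlaneSet, ← range_coe, ← Set.image_univ]
    apply TendstoLocallyUniformlyOn.comp (s := ⊤) _ _ _ (OpenPartialHomeomorph.continuousOn_symm _)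
    · simp only [Set.top_eq_univ, tendstoLocallyUniformlyOn_univ]
      exact weightedEisensteinSeries_tendstoLocallyUniformly hC hk
    · simp only [Topology.IsOpenEmbedding.toOpenPartialHomeomorph_target, Set.top_eq_univ,
        Set.mapsTo_range_iff, Set.mem_univ, forall_const]
  exact h.differentiableOn (Filter.Eventually.of_forall fun s ↦ DifferentiableOn.fun_sum
    fun v _ ↦ (eisSummand_extension_differentiableOn k v).const_mul (c v)) isOpen_upperHalfPlaneSet

lemma isBoundedAtImInfty_weightedEisensteinSeries {N : ℕ} [NeZero N] {c : (Fin 2 → ℤ) → ℂ}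
    (hc : ∀ γ ∈ Gamma N, ∀ v : Fin 2 → ℤ, c (v ᵥ* (γ : Matrix (Fin 2) (Fin 2) ℤ)) = c v) {C : ℝ}
    (hC : ∀ v, ‖c v‖ ≤ C) {k : ℤ} (hk : 3 ≤ k) :
    IsBoundedAtImInfty (weightedEisensteinSeries c k) := by
  have hk' : (2 : ℝ) < k := by norm_cast
  have hC0 : 0 ≤ C := (norm_nonneg _).trans (hC 0)
  rw [UpperHalfPlane.isBoundedAtImInfty_iff]
  refine ⟨∑' x : Fin 2 → ℤ, C * (r ⟨⟨N, 2⟩, Nat.ofNat_pos⟩ ^ (-k) * ‖x‖ ^ (-k)), 2, ?_⟩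
  intro z hz
  obtain ⟨n, hn⟩ := ModularGroup_T_zpow_mem_verticalStrip z (NeZero.pos N)
  have hinv := SlashInvariantForm.T_zpow_width_invariant N k n
    (weightedEisensteinSeriesSIF c hc k) z
  change weightedEisensteinSeries c k _ = weightedEisensteinSeries c k _ at hinv
  rw [← hinv]
  refine tsum_of_norm_bounded (Summable.hasSum ?_) fun v ↦ ?_
  · exact_mod_cast ((summable_one_div_norm_rpow hk').mul_left <|
      r ⟨⟨N, 2⟩, Nat.ofNat_pos⟩ ^ (-k)).mul_left C
  · rw [norm_mul]
    refine mul_le_mul (hC v) ?_ (norm_nonneg _) hC0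
    simp_rw [eisSummand, norm_zpow]
    exact_mod_cast summand_bound_of_mem_verticalStrip (lt_trans two_pos hk').le v two_pos
      (verticalStrip_anti_right N hz hn)

/-- Weighted Eisenstein series of weight `k ≥ 3` with bounded `Γ(N)`-invariant weights are
modular forms for `Γ(N)`. -/
noncomputable def weightedEisensteinSeriesMF {N : ℕ} [NeZero N] (c : (Fin 2 → ℤ) → ℂ)
    (hc : ∀ γ ∈ Gamma N, ∀ v : Fin 2 → ℤ, c (v ᵥ* (γ : Matrix (Fin 2) (Fin 2) ℤ)) = c v) {C : ℝ}
    (hC : ∀ v, ‖c v‖ ≤ C) {k : ℤ} (hk : 3 ≤ k) : ModularForm (Gamma N) k where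
  toFun := weightedEisensteinSeriesSIF c hc k
  slash_action_eq' := (weightedEisensteinSeriesSIF c hc k).slash_action_eq'
  holo' := weightedEisensteinSeries_mdifferentiable hC hk
  bdd_at_cusps' {x} hx := by
    rw [Subgroup.IsArithmetic.isCusp_iff_isCusp_SL2Z] at hx
    rw [OnePoint.isBoundedAt_iff_forall_SL2Z hx]
    intro γ _
    change IsBoundedAtImInfty (weightedEisensteinSeries c k ∣[k] γ)
    rw [weightedEisensteinSeries_slash]
    refine isBoundedAtImInfty_weightedEisensteinSeries (N := N) (fun δ hδ v ↦ ?_)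
      (fun v ↦ hC _) hk
    rw [← hc (γ * δ * γ⁻¹) ((Gamma_normal N).conj_mem δ hδ γ) (v ᵥ* ((γ⁻¹ : SL(2, ℤ)) : Matrix (Fin 2) (Fin 2) ℤ))]
    rw [vecMul_vecMul, vecMul_vecMul]
    have h : δ * γ⁻¹ = γ⁻¹ * (γ * δ * γ⁻¹) := by group
    exact congrArg (fun A : SL(2, ℤ) ↦ c (v ᵥ* (A : Matrix (Fin 2) (Fin 2) ℤ))) h

lemma intCast_vecMul_of_mem_Gamma {N : ℕ} {γ : SL(2, ℤ)} (hγ : γ ∈ Gamma N) (v : Fin 2 → ℤ)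
    (i : Fin 2) : (((v ᵥ* (γ : Matrix (Fin 2) (Fin 2) ℤ)) i : ℤ) : ZMod N) = (v i : ZMod N) := by
  rw [Gamma_mem] at hγ
  obtain ⟨h00, h01, h10, h11⟩ := hγ
  fin_cases i <;> simp [vecMul, vec2_dotProduct, h00, h01, h10, h11]

theorem statement1 (N k : ℕ) (hN : 1 ≤ N) (hk : 1 ≤ k) (φ : ZMod N → ZMod N → ℂ) :
    letI : NeZero N := ⟨by omega⟩
    ∃ F : ModularForm (CongruenceSubgroup.Gamma N) ((k : ℤ) + 2),
      ∀ τ : UpperHalfPlane, F τ = ∑' x : ℤ × ℤ, eisTerm N k φ τ x := by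
  have : NeZero N := ⟨by omega⟩
  obtain ⟨C, hC⟩ := (Set.finite_range fun p : ZMod N × ZMod N ↦
    ‖sympF N φ p.1 p.2‖).bddAbove
  refine ⟨weightedEisensteinSeriesMF (fun v ↦ sympF N φ (v 1 : ZMod N) (v 0 : ZMod N))
    (fun γ hγ v ↦ by simp only [intCast_vecMul_of_mem_Gamma hγ]) (C := C)
    (fun v ↦ hC ⟨((v 1 : ZMod N), (v 0 : ZMod N)), rfl⟩) (by omega), fun τ ↦ ?_⟩
  change weightedEisensteinSeries _ _ τ = _
  rw [weightedEisensteinSeries,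
    ← ((Equiv.prodComm ℤ ℤ).trans (finTwoArrowEquiv ℤ).symm).tsum_eq]
  refine tsum_congr fun x ↦ ?_
  by_cases hx : x = 0
  · have hk0 : -2 + -(k : ℤ) ≠ 0 := by omega
    simp [hx, eisTerm, eisSummand, _root_.zero_zpow _ hk0]
  · simp [eisTerm, eisSummand, hx, add_comm]
end

section
/- Let p be a prime, N ≥ 3 an integer with p ∤ N, k ≥ 1 an integer, f : (ℤ/Nℤ)² → ℤ_p a function, and n ≥ 1 an integer. For each integer r ≥ 0 set b_r := Σ_{d,d' ≥ 1, d·d' = n} ( d^{k+1}·d'^r·f(d̄, d̄') − (−d)^{k+1}·(−d')^r·f(−d̄, −d̄') ) − [p ∣ n]·Σ_{d,e ≥ 1, d·e = n/p} ( d^{k+1}·(pe)^r·f(d̄, p̄ē) − (−d)^{k+1}·(−pe)^r·f(−d̄, −p̄ē) ) ∈ ℤ_p, where a bar denotes reduction modulo N and [p ∣ n] is 1 if p divides n and 0 otherwise. Then there exists a ℚ_p-linear map μ : C(ℤ_p, ℚ_p) → ℚ_p satisfying |μ(ψ)|_p ≤ sup_{x ∈ ℤ_p} |ψ(x)|_p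 for all ψ, such that μ(x ↦ x^r) = b_r for every integer r ≥ 0. (The b_r are the n-th q-expansion coefficients of the moments 2Φ^{(p)}_{k+1,r,f} of the Katz-type p-adic Eisenstein measure μ_N^{k+1} on ℤ_p × (ℤ/Nℤ)².) -/
/-- The `n`-th `q`-expansion coefficient `b_r` of the moment `2Φ^{(p)}_{k+1,r,f}` of the
Katz-type `p`-adic Eisenstein measure: the sum over factorizations `d·d' = n` minus (when `p ∣ n`)
the sum over factorizations `d·e = n/p`. -/
noncomputable def bcoef (p : ℕ) [Fact p.Prime] (N k n : ℕ)
    (f : ZMod N → ZMod N → ℤ_[p]) (r : ℕ) : ℤ_[p] :=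
  (∑ d ∈ n.divisors,
      ((d : ℤ_[p]) ^ (k + 1) * ((n / d : ℕ) : ℤ_[p]) ^ r * f (d : ZMod N) ((n / d : ℕ) : ZMod N) -
        (-(d : ℤ_[p])) ^ (k + 1) * (-((n / d : ℕ) : ℤ_[p])) ^ r *
          f (-(d : ZMod N)) (-((n / d : ℕ) : ZMod N)))) -
  (if p ∣ n then
      ∑ d ∈ (n / p).divisors,
        ((d : ℤ_[p]) ^ (k + 1) * ((p * (n / p / d) : ℕ) : ℤ_[p]) ^ r *
            f (d : ZMod N) ((p * (n / p / d) : ℕ) : ZMod N) -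
          (-(d : ℤ_[p])) ^ (k + 1) * (-((p * (n / p / d) : ℕ) : ℤ_[p])) ^ r *
            f (-(d : ZMod N)) (-((p * (n / p / d) : ℕ) : ZMod N)))
    else 0)

/-- The continuous map `x ↦ x^r` from `ℤ_p` to `ℚ_p`. -/
noncomputable def powCM (p : ℕ) [Fact p.Prime] (r : ℕ) : C(ℤ_[p], ℚ_[p]) :=
  ⟨fun x => ((x : ℚ_[p]) ^ r), by fun_prop⟩

/-- A sequence in `ℤ_p` is a moment sequence if it consists of the moments of a `ℤ_p`-valued
measure on `ℤ_p`, that is, of a linear functional on `C(ℤ_p, ℚ_p)` of norm at most `1`. -/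
def IsMomentSeq (p : ℕ) [Fact p.Prime] (b : ℕ → ℤ_[p]) : Prop :=
  ∃ μ : C(ℤ_[p], ℚ_[p]) →ₗ[ℚ_[p]] ℚ_[p],
    (∀ ψ : C(ℤ_[p], ℚ_[p]), ‖μ ψ‖ ≤ ‖ψ‖) ∧ ∀ r : ℕ, μ (powCM p r) = ((b r : ℤ_[p]) : ℚ_[p])

namespace IsMomentSeq

variable {p : ℕ} [Fact p.Prime]

lemma zero : IsMomentSeq p fun _ => 0 :=
  ⟨0, fun ψ => by simp, fun r => by simp⟩

lemma sub {a b : ℕ → ℤ_[p]} (ha : IsMomentSeq p a) (hb : IsMomentSeq p b) :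
    IsMomentSeq p fun r => a r - b r := by
  obtain ⟨μ, hμ, hμa⟩ := ha
  obtain ⟨ν, hν, hνb⟩ := hb
  refine ⟨μ - ν, fun ψ => ?_, fun r => by simp [hμa, hνb]⟩
  rw [LinearMap.sub_apply, sub_eq_add_neg]
  refine (IsUltrametricDist.norm_add_le_max _ _).trans (max_le (hμ ψ) ?_)
  rw [norm_neg]
  exact hν ψ

lemma add {a b : ℕ → ℤ_[p]} (ha : IsMomentSeq p a) (hb : IsMomentSeq p b) :
    IsMomentSeq p fun r => a r + b r := by
  simpa using ha.sub (zero.sub hb)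

lemma sum {ι : Type*} (s : Finset ι) {a : ι → ℕ → ℤ_[p]} (ha : ∀ i, IsMomentSeq p (a i)) :
    IsMomentSeq p fun r => ∑ i ∈ s, a i r := by
  classical
  induction s using Finset.induction_on with
  | empty => simpa using zero
  | insert i s hi ih => simpa [Finset.sum_insert hi] using (ha i).add ih

/-- The moments of a multiple of the Dirac measure at `x`. -/
lemma dirac (c x e : ℤ_[p]) : IsMomentSeq p fun r => c * x ^ r * e := by
  refine ⟨((c * e : ℤ_[p]) : ℚ_[p]) • (ContinuousMap.evalCLM ℚ_[p] x).toLinearMap,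
    fun ψ => ?_, fun r => ?_⟩
  · have h := (c * e).norm_le_one
    calc ‖((c * e : ℤ_[p]) : ℚ_[p]) • ψ x‖ = ‖c * e‖ * ‖ψ x‖ := by
          rw [norm_smul, PadicInt.norm_def]
      _ ≤ 1 * ‖ψ‖ := by gcongr; exact ψ.norm_coe_le_norm x
      _ = ‖ψ‖ := one_mul _
  · change ((c * e : ℤ_[p]) : ℚ_[p]) * (x : ℚ_[p]) ^ r = _
    push_cast
    ring

end IsMomentSeq

theorem statement6 (p N k n : ℕ) [Fact p.Prime] (hN : 3 ≤ N) (hpN : ¬ p ∣ N)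
    (hk : 1 ≤ k) (hn : 1 ≤ n) (f : ZMod N → ZMod N → ℤ_[p]) :
    ∃ μ : C(ℤ_[p], ℚ_[p]) →ₗ[ℚ_[p]] ℚ_[p],
      (∀ ψ : C(ℤ_[p], ℚ_[p]), ‖μ ψ‖ ≤ ‖ψ‖) ∧
      ∀ r : ℕ, μ (powCM p r) = ((bcoef p N k n f r : ℤ_[p]) : ℚ_[p]) := by
  change IsMomentSeq p (bcoef p N k n f)
  unfold bcoef
  refine IsMomentSeq.sub (IsMomentSeq.sum _ fun d => (IsMomentSeq.dirac _ _ _).sub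
    (IsMomentSeq.dirac _ _ _)) ?_
  split_ifs
  · exact IsMomentSeq.sum _ fun d => (IsMomentSeq.dirac _ _ _).sub (IsMomentSeq.dirac _ _ _)
  · exact IsMomentSeq.zero
end

section
/- Let p be a prime, N ≥ 3 an integer with p ∤ N, k ≥ 1 an integer, f : (ℤ/Nℤ)² → ℤ_p a function, and n ≥ 1 an integer, and let b_r ∈ ℤ_p (r ≥ 0) be defined by b_r := Σ_{d,d' ≥ 1, d·d' = n} ( d^{k+1}·d'^r·f(d̄, d̄') − (−d)^{k+1}·(−d')^r·f(−d̄, −d̄') ) − [p ∣ n]·Σ_{d,e ≥ 1, d·e = n/p} ( d^{k+1}·(pe)^r·f(d̄, p̄ē) − (−d)^{k+1}·(−pe)^r·f(−d̄, −p̄ē) ). Then every ℚ_p-linear map μ : C(ℤ_p, ℚ_p) → ℚ_p with |μ(ψ)|_p ≤ sup_{x ∈ ℤ_p} |ψ(x)|_p for all ψ and with μ(x ↦ x^r) = b_r for all r ≥ 0 satisfies μ(ψ) = 0 for every continuous ψ : ℤ_p → ℚ_p vanishing on the p-adic units ℤ_p^×. (The measure μ_N^{k+1} has support on ℤ_p^×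 × (ℤ/Nℤ)².) -/
open Polynomial in
/-- The continuous function `ℤ_p → ℚ_p` defined by a polynomial over `ℚ_p`. -/
noncomputable def polyCM {p : ℕ} [Fact p.Prime] (P : ℚ_[p][X]) : C(ℤ_[p], ℚ_[p]) :=
  ⟨fun x => P.eval (x : ℚ_[p]), by fun_prop⟩

open Polynomial in
lemma polyCM_eq_sum {p : ℕ} [Fact p.Prime] (P : ℚ_[p][X]) :
    polyCM P = ∑ i ∈ Finset.range (P.natDegree + 1), P.coeff i • powCM p i := by
  ext x
  simp [polyCM, powCM, eval_eq_sum_range]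

/-- The `p`-adic norm on `ℚ_p` is compatible with the action of `ℤ_p`. -/
instance PadicInt.isBoundedSMulPadic {p : ℕ} [Fact p.Prime] : IsBoundedSMul ℤ_[p] ℚ_[p] :=
  IsBoundedSMul.of_norm_smul_le fun x y ↦ by
    rw [Algebra.smul_def, norm_mul]
    rfl

open Polynomial in
/-- Each term of a `ℚ_p`-valued Mahler series is a polynomial function. -/
lemma mahlerTerm_eq_polyCM {p : ℕ} [Fact p.Prime] (a : ℚ_[p]) (m : ℕ) :
    PadicInt.mahlerTerm a m = polyCM (C (a / (m.factorial : ℚ_[p])) * descPochhammer ℚ_[p] m) := by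
  refine ContinuousMap.coe_injective (PadicInt.denseRange_natCast.equalizer
    (map_continuous _) (map_continuous _) (funext fun j ↦ ?_))
  have hm : (m.factorial : ℚ_[p]) ≠ 0 := mod_cast m.factorial_ne_zero
  simp only [Function.comp_apply, PadicInt.mahlerTerm_apply, mahler_natCast_eq, polyCM,
    ContinuousMap.coe_mk, PadicInt.coe_natCast, eval_mul, eval_C,
    descPochhammer_eval_eq_descFactorial, Nat.descFactorial_eq_factorial_mul_choose,
    Nat.cast_mul, Nat.cast_smul_eq_nsmul, nsmul_eq_mul]
  field_simp

/-- A continuous linear functional on `C(ℤ_p, ℚ_p)` is determined by its moments. -/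
lemma continuousLinearMap_ext_of_moments {p : ℕ} [Fact p.Prime]
    {L M : C(ℤ_[p], ℚ_[p]) →L[ℚ_[p]] ℚ_[p]} (h : ∀ r, L (powCM p r) = M (powCM p r)) :
    L = M := by
  ext ψ
  have hψ := PadicInt.hasSum_mahler ψ
  refine (L.hasSum hψ).unique ?_
  convert M.hasSum hψ using 2 with m
  simp only [mahlerTerm_eq_polyCM, polyCM_eq_sum, map_sum, map_smul, h]

/-- If `F d m` vanishes unless `p ∣ m`, then the sum of `F` over the factorizations of `n` may be
rewritten as a sum over the factorizations of `n / p`. -/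
lemma sum_divisors_eq_of_eq_zero_of_not_dvd {M : Type*} [AddCommMonoid M] {p n : ℕ} (hn : n ≠ 0)
    (F : ℕ → ℕ → M) (hF : ∀ d m, ¬ p ∣ m → F d m = 0) :
    ∑ d ∈ n.divisors, F d (n / d) =
      if p ∣ n then ∑ d ∈ (n / p).divisors, F d (p * (n / p / d)) else 0 := by
  split_ifs with h
  · obtain ⟨t, rfl⟩ := h
    have hp : 0 < p := Nat.pos_of_ne_zero (left_ne_zero_of_mul hn)
    rw [Nat.mul_div_cancel_left _ hp]
    have hsub : t.divisors ⊆ (p * t).divisors := Nat.divisors_subset_of_dvd hn (dvd_mul_left t p)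
    rw [← Finset.sum_subset hsub]
    · refine Finset.sum_congr rfl fun d hd ↦ ?_
      rw [Nat.mul_div_assoc _ (Nat.dvd_of_mem_divisors hd)]
    · intro d hd hd'
      refine hF _ _ fun ⟨e, he⟩ ↦ hd' ?_
      have hde := Nat.div_mul_cancel (Nat.dvd_of_mem_divisors hd)
      rw [he, mul_assoc] at hde
      exact Nat.mem_divisors.2
        ⟨⟨e, by rw [mul_comm d]; exact (Nat.eq_of_mul_eq_mul_left hp hde).symm⟩,
          right_ne_zero_of_mul hn⟩
  · refine Finset.sum_eq_zero fun d hd ↦ hF _ _ fun hd' ↦ h ?_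
    exact hd'.trans (Nat.div_dvd_of_dvd (Nat.dvd_of_mem_divisors hd))

/-- The combination of Dirac measures at `m` and `-m` whose moments are the summands of `bcoef`
attached to the factorization `d * m`. -/
noncomputable def diracPair (p : ℕ) [Fact p.Prime] (N k : ℕ) (f : ZMod N → ZMod N → ℤ_[p])
    (d m : ℕ) : C(ℤ_[p], ℚ_[p]) →L[ℚ_[p]] ℚ_[p] :=
  (((d : ℤ_[p]) ^ (k + 1) * f d m : ℤ_[p]) : ℚ_[p]) •
      ContinuousMap.evalCLM ℚ_[p] (m : ℤ_[p]) -
    (((-(d : ℤ_[p])) ^ (k + 1) * f (-d) (-m) : ℤ_[p]) : ℚ_[p]) •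
      ContinuousMap.evalCLM ℚ_[p] (-(m : ℤ_[p]))

lemma diracPair_apply (p : ℕ) [Fact p.Prime] (N k : ℕ) (f : ZMod N → ZMod N → ℤ_[p])
    (d m : ℕ) (ψ : C(ℤ_[p], ℚ_[p])) :
    diracPair p N k f d m ψ =
      (((d : ℤ_[p]) ^ (k + 1) * f d m : ℤ_[p]) : ℚ_[p]) * ψ m -
        (((-(d : ℤ_[p])) ^ (k + 1) * f (-d) (-m) : ℤ_[p]) : ℚ_[p]) * ψ (-m) := by
  simp [diracPair, ContinuousMap.evalCLM]

lemma diracPair_powCM (p : ℕ) [Fact p.Prime] (N k : ℕ) (f : ZMod N → ZMod N → ℤ_[p])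
    (d m r : ℕ) :
    diracPair p N k f d m (powCM p r) =
      (((d : ℤ_[p]) ^ (k + 1) * (m : ℤ_[p]) ^ r * f d m -
        (-(d : ℤ_[p])) ^ (k + 1) * (-(m : ℤ_[p])) ^ r * f (-d) (-m) : ℤ_[p]) : ℚ_[p]) := by
  rw [diracPair_apply]
  simp only [powCM, ContinuousMap.coe_mk]
  push_cast
  ring

lemma diracPair_eq_zero {p : ℕ} [Fact p.Prime] (N k : ℕ) (f : ZMod N → ZMod N → ℤ_[p])
    {ψ : C(ℤ_[p], ℚ_[p])} (hψ : ∀ x : ℤ_[p], IsUnit x → ψ x = 0) (d m : ℕ) (hm : ¬ p ∣ m) :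
    diracPair p N k f d m ψ = 0 := by
  have hu : IsUnit (m : ℤ_[p]) := by
    rw [PadicInt.isUnit_iff]
    refine le_antisymm (PadicInt.norm_le_one _) (not_lt.1 fun h ↦ hm ?_)
    exact_mod_cast (PadicInt.norm_int_lt_one_iff_dvd (p := p) (m : ℤ)).1 (by exact_mod_cast h)
  rw [diracPair_apply, hψ _ hu, hψ _ hu.neg, mul_zero, mul_zero, sub_zero]

theorem statement7 (p N k n : ℕ) [Fact p.Prime] (hN : 3 ≤ N) (hpN : ¬ p ∣ N)
    (hk : 1 ≤ k) (hn : 1 ≤ n) (f : ZMod N → ZMod N → ℤ_[p]) :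
    ∀ μ : C(ℤ_[p], ℚ_[p]) →ₗ[ℚ_[p]] ℚ_[p],
      (∀ ψ : C(ℤ_[p], ℚ_[p]), ‖μ ψ‖ ≤ ‖ψ‖) →
      (∀ r : ℕ, μ (powCM p r) = ((bcoef p N k n f r : ℤ_[p]) : ℚ_[p])) →
      ∀ ψ : C(ℤ_[p], ℚ_[p]), (∀ x : ℤ_[p], IsUnit x → ψ x = 0) → μ ψ = 0 := by
  intro μ hμ hmom ψ hψ
  let ν : C(ℤ_[p], ℚ_[p]) →L[ℚ_[p]] ℚ_[p] :=
    ∑ d ∈ n.divisors, diracPair p N k f d (n / d) -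
      if p ∣ n then ∑ d ∈ (n / p).divisors, diracPair p N k f d (p * (n / p / d)) else 0
  have hμν : μ.mkContinuous 1 (fun φ ↦ by simpa using hμ φ) = ν := by
    refine continuousLinearMap_ext_of_moments fun r ↦ ?_
    rw [LinearMap.mkContinuous_apply, hmom r]
    simp only [ν, bcoef]
    split_ifs
    · simp only [diracPair_powCM, sub_apply,
        sum_apply, PadicInt.coe_sub, PadicInt.coe_sum]
    · simp only [diracPair_powCM, sub_apply,
        sum_apply, PadicInt.coe_sub, PadicInt.coe_sum, PadicInt.coe_zero,
        zero_apply]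
  have hνψ : ν ψ = 0 := by
    have key := sum_divisors_eq_of_eq_zero_of_not_dvd (p := p) (Nat.one_le_iff_ne_zero.1 hn)
      (fun d m ↦ diracPair p N k f d m ψ) (diracPair_eq_zero N k f hψ)
    simp only [ν, sub_apply, sum_apply, key]
    split_ifs <;> simp
  rw [← hνψ, ← hμν, LinearMap.mkContinuous_apply]
end

section
/- Let p be a prime, N ≥ 3 an integer with p ∤ N, k ≥ 1 an integer, f : (ℤ/Nℤ)² → ℤ_p a function, and n ≥ 1 an integer, and let b_r ∈ ℤ_p (r ≥ 0) be defined by b_r := Σ_{d,d' ≥ 1, d·d' = n} ( d^{k+1}·d'^r·f(d̄, d̄') − (−d)^{k+1}·(−d')^r·f(−d̄, −d̄') ) − [p ∣ n]·Σ_{d,e ≥ 1, d·e = n/p} ( d^{k+1}·(pe)^r·f(d̄, p̄ē) − (−d)^{k+1}·(−pe)^r·f(−d̄, −p̄ē) ). Then every ℚ_p-linear map μ : C(ℤ_p, ℚ_p) → ℚ_p with |μ(ψ)|_p ≤ sup_{x ∈ ℤ_p} |ψ(x)|_p for all ψ and with μ(x ↦ x^r) = b_r for all r ≥ 0 satisfies,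 for EVERY integer r ∈ ℤ (including negative r), μ(ψ_r) = Σ_{d,d' ≥ 1, d·d' = n, p ∤ d'} ( d^{k+1}·d'^r·f(d̄, d̄') − (−d)^{k+1}·(−d')^r·f(−d̄, −d̄') ), where ψ_r : ℤ_p → ℚ_p is the continuous function with ψ_r(x) = x^r for x ∈ ℤ_p^× and ψ_r(x) = 0 for x ∈ pℤ_p (here d'^r ∈ ℤ_p makes sense since p ∤ d'). (This gives the n-th q-expansion coefficient of the p-adic Eisenstein series 2Φ^{(p)}_{k+1,r,f}, hence of the p-adic Eisenstein–Kronecker series, for all integers r.) -/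
/-- Powers of the coordinate span a dense subspace of `C(ℤ_p, ℚ_p)`, by Mahler's theorem. -/
theorem dense_span_range_powCM (p : ℕ) [Fact p.Prime] :
    Dense (Submodule.span ℚ_[p] (Set.range (powCM p)) : Set C(ℤ_[p], ℚ_[p])) := by
  have : IsBoundedSMul ℤ_[p] ℚ_[p] :=
    .of_norm_smul_le fun x y => (norm_mul (x : ℚ_[p]) y).le
  intro ψ
  have hterm : ∀ (a : ℚ_[p]) (n : ℕ),
      (PadicInt.mahlerTerm a n : C(ℤ_[p], ℚ_[p])) ∈ Submodule.span ℚ_[p] (Set.range (powCM p)) := by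
    intro a n
    set P : Polynomial ℤ := descPochhammer ℤ n with hP
    have heq : (PadicInt.mahlerTerm a n : C(ℤ_[p], ℚ_[p])) =
        ∑ i ∈ P.support, ((a / (n.factorial : ℚ_[p])) * (P.coeff i : ℚ_[p])) • powCM p i := by
      ext x
      have hfac : (n.factorial : ℚ_[p]) ≠ 0 := Nat.cast_ne_zero.mpr n.factorial_ne_zero
      have h := Ring.descPochhammer_eq_factorial_smul_choose x n
      rw [← hP, Polynomial.smeval_eq_sum, Polynomial.sum] at h
      have h' := congrArg (fun z : ℤ_[p] => (z : ℚ_[p])) h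
      simp only [Polynomial.smul_pow, nsmul_eq_mul, zsmul_eq_mul, PadicInt.coe_sum,
        PadicInt.coe_mul, PadicInt.coe_intCast, PadicInt.coe_pow, PadicInt.coe_natCast] at h'
      have hsum : (∑ i ∈ P.support,
          ((a / (n.factorial : ℚ_[p])) * (P.coeff i : ℚ_[p])) • powCM p i) x =
          a / (n.factorial : ℚ_[p]) *
            ∑ i ∈ P.support, (P.coeff i : ℚ_[p]) * (x : ℚ_[p]) ^ i := by
        simp [powCM, Finset.mul_sum, mul_assoc]
      rw [hsum, h', PadicInt.mahlerTerm_apply, mahler_apply]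
      change ((Ring.choose x n : ℤ_[p]) : ℚ_[p]) * a = _
      field_simp
    rw [heq]
    exact Submodule.sum_mem _ fun i _ =>
      Submodule.smul_mem _ _ (Submodule.subset_span ⟨i, rfl⟩)
  exact mem_closure_of_tendsto (PadicInt.hasSum_mahler ψ)
    (Filter.Eventually.of_forall fun s => Submodule.sum_mem _ fun n _ => hterm _ n)

/-- The map `x ↦ x ^ r` on `ℤ_p^×`, extended by zero to `ℤ_p`, is continuous for `r : ℤ`. -/
theorem continuous_indicator_isUnit_zpow (p : ℕ) [Fact p.Prime] (r : ℤ) :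
    Continuous ({x : ℤ_[p] | IsUnit x}.indicator fun x => (x : ℚ_[p]) ^ r) := by
  have hs : {x : ℤ_[p] | IsUnit x} = norm ⁻¹' {1} := by
    ext x; simp [PadicInt.isUnit_iff]
  have hclopen : IsClopen {x : ℤ_[p] | IsUnit x} := by
    refine ⟨?_, Units.isOpen⟩
    rw [hs]
    exact isClosed_singleton.preimage continuous_norm
  refine continuous_indicator (fun x hx => ?_) ?_
  · simp [hclopen.frontier_eq] at hx
  · rw [hclopen.isClosed.closure_eq]
    refine ContinuousOn.zpow₀ (by fun_prop) r fun x hx => Or.inl ?_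
    exact fun h => hx.ne_zero (PadicInt.coe_eq_zero.mp h)

theorem sum_divisors_sub_sum_divisors_div {M : Type*} [AddCommGroup M] {p n : ℕ}
    (hp : p ≠ 0) (hn : n ≠ 0) (F : ℕ → ℕ → M) :
    (∑ d ∈ n.divisors, F d (n / d)) -
        (if p ∣ n then ∑ d ∈ (n / p).divisors, F d (p * (n / p / d)) else 0) =
      ∑ d ∈ n.divisors.filter (fun d => ¬ p ∣ n / d), F d (n / d) := by
  rw [← Finset.sum_filter_add_sum_filter_not n.divisors (fun d => p ∣ n / d), add_sub_right_comm,
    add_eq_right, sub_eq_zero]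
  split_ifs with h
  · obtain ⟨m, rfl⟩ := h
    have hm : m ≠ 0 := right_ne_zero_of_mul hn
    have hp' := Nat.pos_of_ne_zero hp
    rw [Nat.mul_div_cancel_left m hp']
    refine Finset.sum_congr ?_ ?_
    · ext d
      simp only [Finset.mem_filter, Nat.mem_divisors]
      constructor
      · rintro ⟨⟨hd, -⟩, e, he⟩
        have h1 := Nat.mul_div_cancel' hd
        rw [he] at h1
        refine ⟨⟨e, ?_⟩, hm⟩
        apply Nat.eq_of_mul_eq_mul_left hp'
        rw [← h1]; ring
      · rintro ⟨hd, -⟩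
        exact ⟨⟨hd.mul_left p, hn⟩, m / d, Nat.mul_div_assoc p hd⟩
    · intro d hd
      rw [Nat.mul_div_assoc p (Nat.dvd_of_mem_divisors hd)]
  · refine Finset.sum_eq_zero fun d hd => ?_
    rw [Finset.mem_filter, Nat.mem_divisors] at hd
    exact absurd (hd.2.trans (Nat.div_dvd_of_dvd hd.1.1)) h

/-- The finite combination of Dirac measures with `r`-th moment `bcoef p N k n f r`. -/
noncomputable def eisensteinMeasure (p : ℕ) [Fact p.Prime] (N k n : ℕ)
    (f : ZMod N → ZMod N → ℤ_[p]) : C(ℤ_[p], ℚ_[p]) →L[ℚ_[p]] ℚ_[p] :=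
  ∑ d ∈ n.divisors.filter (fun d => ¬ p ∣ n / d),
    (((d : ℚ_[p]) ^ (k + 1) * (f (d : ZMod N) ((n / d : ℕ) : ZMod N) : ℚ_[p])) •
        ContinuousMap.evalCLM ℚ_[p] ((n / d : ℕ) : ℤ_[p]) -
      ((-(d : ℚ_[p])) ^ (k + 1) * (f (-(d : ZMod N)) (-((n / d : ℕ) : ZMod N)) : ℚ_[p])) •
        ContinuousMap.evalCLM ℚ_[p] (-((n / d : ℕ) : ℤ_[p])))

theorem eisensteinMeasure_apply (p : ℕ) [Fact p.Prime] (N k n : ℕ)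
    (f : ZMod N → ZMod N → ℤ_[p]) (ψ : C(ℤ_[p], ℚ_[p])) :
    eisensteinMeasure p N k n f ψ = ∑ d ∈ n.divisors.filter (fun d => ¬ p ∣ n / d),
      ((d : ℚ_[p]) ^ (k + 1) * ψ ((n / d : ℕ) : ℤ_[p]) *
          (f (d : ZMod N) ((n / d : ℕ) : ZMod N) : ℚ_[p]) -
        (-(d : ℚ_[p])) ^ (k + 1) * ψ (-((n / d : ℕ) : ℤ_[p])) *
          (f (-(d : ZMod N)) (-((n / d : ℕ) : ZMod N)) : ℚ_[p])) := by
  rw [eisensteinMeasure, sum_apply]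
  refine Finset.sum_congr rfl fun d _ => ?_
  simp only [sub_apply, smul_apply,
    ContinuousMap.evalCLM_apply, smul_eq_mul]
  ring

theorem eisensteinMeasure_powCM (p : ℕ) [Fact p.Prime] (N k n : ℕ) (hn : n ≠ 0)
    (f : ZMod N → ZMod N → ℤ_[p]) (r : ℕ) :
    eisensteinMeasure p N k n f (powCM p r) = ((bcoef p N k n f r : ℤ_[p]) : ℚ_[p]) := by
  have h := sum_divisors_sub_sum_divisors_div (Fact.out : p.Prime).ne_zero hn
    (fun d e => (d : ℤ_[p]) ^ (k + 1) * (e : ℤ_[p]) ^ r * f (d : ZMod N) (e : ZMod N) -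
      (-(d : ℤ_[p])) ^ (k + 1) * (-(e : ℤ_[p])) ^ r * f (-(d : ZMod N)) (-(e : ZMod N)))
  rw [bcoef, h, eisensteinMeasure_apply, PadicInt.coe_sum]
  refine Finset.sum_congr rfl fun d _ => ?_
  simp only [powCM, ContinuousMap.coe_mk, PadicInt.coe_sub, PadicInt.coe_mul, PadicInt.coe_pow,
    PadicInt.coe_neg, PadicInt.coe_natCast]

theorem statement8 (p N k n : ℕ) [Fact p.Prime] (hN : 3 ≤ N) (hpN : ¬ p ∣ N)
    (hk : 1 ≤ k) (hn : 1 ≤ n) (f : ZMod N → ZMod N → ℤ_[p]) :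
    ∀ μ : C(ℤ_[p], ℚ_[p]) →ₗ[ℚ_[p]] ℚ_[p],
      (∀ ψ : C(ℤ_[p], ℚ_[p]), ‖μ ψ‖ ≤ ‖ψ‖) →
      (∀ r : ℕ, μ (powCM p r) = ((bcoef p N k n f r : ℤ_[p]) : ℚ_[p])) →
      ∀ r : ℤ, ∃ ψ : C(ℤ_[p], ℚ_[p]),
        (∀ x : ℤ_[p], IsUnit x → ψ x = ((x : ℚ_[p]) ^ r)) ∧
        (∀ x : ℤ_[p], ¬ IsUnit x → ψ x = 0) ∧
        μ ψ = ∑ d ∈ n.divisors.filter (fun d => ¬ p ∣ n / d),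
          ((d : ℚ_[p]) ^ (k + 1) * ((n / d : ℕ) : ℚ_[p]) ^ r *
              (f (d : ZMod N) ((n / d : ℕ) : ZMod N) : ℚ_[p]) -
            (-(d : ℚ_[p])) ^ (k + 1) * (-((n / d : ℕ) : ℚ_[p])) ^ r *
              (f (-(d : ZMod N)) (-((n / d : ℕ) : ZMod N)) : ℚ_[p])) := by
  intro μ hμ hmom r
  have hn0 : n ≠ 0 := Nat.one_le_iff_ne_zero.mp hn
  let μ' : C(ℤ_[p], ℚ_[p]) →L[ℚ_[p]] ℚ_[p] :=
    μ.mkContinuous 1 fun ψ => by simpa using hμ ψ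
  have heq : μ' = eisensteinMeasure p N k n f := by
    refine ContinuousLinearMap.ext_on (dense_span_range_powCM p) ?_
    rintro _ ⟨s, rfl⟩
    exact (hmom s).trans (eisensteinMeasure_powCM p N k n hn0 f s).symm
  refine ⟨⟨{x : ℤ_[p] | IsUnit x}.indicator fun x => (x : ℚ_[p]) ^ r,
      continuous_indicator_isUnit_zpow p r⟩,
    fun x hx => by
      rw [ContinuousMap.coe_mk]; exact Set.indicator_of_mem (s := {x : ℤ_[p] | IsUnit x}) hx _,
    fun x hx => by
      rw [ContinuousMap.coe_mk]; exact Set.indicator_of_notMem (s := {x : ℤ_[p] | IsUnit x}) hx _, ?_⟩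
  change μ' _ = _
  rw [heq, eisensteinMeasure_apply]
  refine Finset.sum_congr rfl fun d hd => ?_
  have hu : IsUnit ((n / d : ℕ) : ℤ_[p]) := by
    rw [PadicInt.isUnit_iff, PadicInt.norm_natCast_eq_one_iff]
    exact (Fact.out : p.Prime).coprime_iff_not_dvd.mpr (Finset.mem_filter.mp hd).2
  simp only [ContinuousMap.coe_mk]
  rw [Set.indicator_of_mem (s := {x : ℤ_[p] | IsUnit x}) hu,
    Set.indicator_of_mem (s := {x : ℤ_[p] | IsUnit x}) hu.neg, PadicInt.coe_neg,
    PadicInt.coe_natCast]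
end
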